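/- Assume the Riemann Hypothesis. There is an absolute constant C > 0 such that for all t ≥ 2 and 0 < h ≤ √t, whenever t, t-h, t+h are not ordinates of zeros of ζ: -(h log t)/(4π) + (1/h)∫_{t-h}^{t} S(u) du - C(h + 1/t) ≤ S(t) ≤ (h log t)/(4π) + (1/h)∫_{t}^{t+h} S(u) du + C(h + 1/t). -/

import Mathlib

open Complex MeasureTheory Real

/-- The argument function `S(t) = -(1/π) ∫_{1/2}^∞ Im(ζ'/ζ)(σ+it) dσ`. -/
noncomputable def S (t : ℝ) : ℝ :=
  -(1 / π) * ∫ σ in Set.Ioi (1 / 2 : ℝ),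
    (deriv riemannZeta ((σ : ℂ) + (t : ℂ) * Complex.I) /
      riemannZeta ((σ : ℂ) + (t : ℂ) * Complex.I)).im

/-- `t` is the ordinate of a nontrivial zero of the Riemann zeta function. -/
def IsZetaZeroOrdinate (t : ℝ) : Prop :=
  ∃ ρ : ℂ, riemannZeta ρ = 0 ∧ 0 < ρ.re ∧ ρ.re < 1 ∧ ρ.im = t

open Filter Topology

/-! ### The digamma function on the right half-plane -/

/-- The derivative of `log ‖·‖` along horizontal lines in the right half-plane. -/
theorem hasDerivAt_log_norm_add_ofReal {z : ℂ} {x : ℝ} (hz : 0 < z.re) (hx : 0 ≤ x) :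
    HasDerivAt (fun y : ℝ ↦ Real.log ‖z + y‖) (((z + x)⁻¹).re) x := by
  have hslit : z + x ∈ slitPlane := Or.inl (by simp; linarith)
  have h1 : HasDerivAt (fun y : ℝ ↦ z + (y : ℂ)) 1 x := by
    simpa using (Complex.ofRealCLM.hasDerivAt (x := x)).const_add z
  have h2 := (reCLM.hasFDerivAt.comp_hasDerivAt x (h1.clog_real hslit))
  simpa [Function.comp_def, Complex.log_re] using h2

/-- A quantitative mean value estimate for `log ‖·‖` along horizontal segments. -/
theorem log_norm_add_ofReal_sub_ge {z : ℂ} {δ : ℝ} (hz : 0 < z.re) (hδ : 0 < δ) (hδ1 : δ ≤ 1) :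
    δ * (Real.log ‖z + 1‖ - Real.log ‖z‖) - δ / z.re ^ 2 ≤
      Real.log ‖z + δ‖ - Real.log ‖z‖ := by
  have key : ∀ y : ℝ, 0 < y → ∃ x ∈ Set.Ioo 0 y,
      ((z + x)⁻¹).re = (Real.log ‖z + y‖ - Real.log ‖z‖) / y := by
    intro y hy
    obtain ⟨x, hx, h⟩ := exists_hasDerivAt_eq_slope (fun y : ℝ ↦ Real.log ‖z + y‖)
      (fun x ↦ ((z + x)⁻¹).re) hy
      (fun x hx ↦ (hasDerivAt_log_norm_add_ofReal hz hx.1).continuousAt.continuousWithinAt)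
      (fun x hx ↦ hasDerivAt_log_norm_add_ofReal hz hx.1.le)
    exact ⟨x, hx, by simpa using h⟩
  obtain ⟨x, hx, hxe⟩ := key δ hδ
  obtain ⟨y, hy, hye⟩ := key 1 one_pos
  have hnorm : ∀ w : ℝ, 0 < w → z.re ≤ ‖z + w‖ := fun w hw ↦
    le_trans (by simp; linarith) (Complex.re_le_norm (z + w))
  have hx0 : z + x ≠ 0 := norm_pos_iff.mp (hz.trans_le (hnorm x hx.1))
  have hy0 : z + y ≠ 0 := norm_pos_iff.mp (hz.trans_le (hnorm y hy.1))
  have hdiff : ((z + y)⁻¹).re - ((z + x)⁻¹).re ≤ 1 / z.re ^ 2 := by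
    rw [← Complex.sub_re]
    refine (Complex.re_le_norm _).trans ?_
    rw [inv_sub_inv hy0 hx0, norm_div, norm_mul]
    have : ‖z + x - (z + y)‖ ≤ 1 := by
      rw [add_sub_add_left_eq_sub, ← Complex.ofReal_sub, Complex.norm_real, Real.norm_eq_abs,
        abs_le]
      constructor <;> linarith [hx.1, hx.2, hy.1, hy.2]
    rw [sq]
    gcongr
    · exact hnorm y hy.1
    · exact hnorm x hx.1
  rw [hxe, hye] at hdiff
  simp only [div_one, Complex.ofReal_one] at hdiff
  have h2 := mul_le_mul_of_nonneg_left hdiff hδ.le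
  rw [mul_sub, mul_div_cancel₀ _ hδ.ne'] at h2
  rw [mul_one_div] at h2
  linarith

theorem log_norm_Gamma_seq_bound {s : ℂ} (hs : 0 < s.re) {δ : ℝ} (hδ : 0 < δ) (hδ1 : δ ≤ 1)
    {M : ℝ} (hM : ∀ n : ℕ, ∑ k ∈ Finset.range n, 1 / (s.re + k) ^ 2 ≤ M) {n : ℕ} (hn : 0 < n) :
    ‖GammaSeq (s + δ) n‖ ≤ ‖GammaSeq s n‖ * Real.exp (δ * (Real.log ‖s‖ + M)) := by
  have hre : ∀ k : ℕ, 0 < (s + k).re := fun k ↦ by simp; positivity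
  have hne : ∀ k : ℕ, s + k ≠ 0 := fun k h ↦ by simpa [h] using hre k
  have hne' : ∀ k : ℕ, s + δ + k ≠ 0 := fun k h ↦ by
    have h1 := hre k
    have h2 := congrArg Complex.re h
    simp at h1 h2
    linarith
  have hn0 : (0 : ℝ) < n := by exact_mod_cast hn
  have hsum : δ * (Real.log n - Real.log ‖s‖) - δ * M ≤
      ∑ k ∈ Finset.range (n + 1), (Real.log ‖s + δ + k‖ - Real.log ‖s + k‖) := by
    calc δ * (Real.log n - Real.log ‖s‖) - δ * M
        ≤ δ * (Real.log ‖s + (n + 1 : ℕ)‖ - Real.log ‖s‖) -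
            δ * ∑ k ∈ Finset.range (n + 1), 1 / (s.re + k) ^ 2 := by
          gcongr
          · refine le_trans ?_ (Complex.re_le_norm _)
            simp
            linarith
          · exact hM _
      _ = ∑ k ∈ Finset.range (n + 1), (δ * (Real.log ‖s + (k + 1 : ℕ)‖ - Real.log ‖s + k‖) -
            δ / (s.re + k) ^ 2) := by
          rw [Finset.sum_sub_distrib, ← Finset.mul_sum,
            Finset.sum_range_sub (fun k : ℕ ↦ Real.log ‖s + k‖), Finset.mul_sum]
          simp [div_eq_mul_inv]
      _ ≤ _ := by
          refine Finset.sum_le_sum fun k _ ↦ ?_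
          have := log_norm_add_ofReal_sub_ge (hre k) hδ hδ1
          rw [add_right_comm s (δ : ℂ)]
          push_cast
          rw [← add_assoc]
          simpa using this
  have hG : ∀ z : ℂ, (∀ k : ℕ, z + k ≠ 0) → ‖GammaSeq z n‖ =
      Real.exp (z.re * Real.log n - ∑ k ∈ Finset.range (n + 1), Real.log ‖z + k‖) *
        (n.factorial : ℝ) := by
    intro z hz
    rw [Complex.GammaSeq, norm_div, norm_mul, Complex.norm_natCast_cpow_of_pos hn, norm_prod,
      Complex.norm_natCast, Real.exp_sub, Real.exp_sum, Real.rpow_def_of_pos hn0, mul_comm z.re,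
      Finset.prod_congr rfl fun k _ ↦ Real.exp_log (norm_pos_iff.mpr (hz k))]
    ring
  rw [hG _ hne, hG _ hne', mul_right_comm, ← Real.exp_add]
  gcongr
  rw [Finset.sum_sub_distrib] at hsum
  simp only [Complex.add_re, Complex.ofReal_re]
  linarith

/-- If `f ≤ 0` to the right of a zero of `f`, then the derivative there is nonpositive. -/
theorem HasDerivAt.nonpos_of_nonpos_right {f : ℝ → ℝ} {f' : ℝ} (hf : HasDerivAt f f' 0)
    (h0 : f 0 = 0) (h : ∀ᶠ x in 𝓝[>] 0, f x ≤ 0) : f' ≤ 0 := by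
  have h1 := (hasDerivWithinAt_iff_tendsto_slope' (s := Set.Ioi 0) (by simp)).mp
    hf.hasDerivWithinAt
  refine le_of_tendsto h1 ?_
  filter_upwards [h, self_mem_nhdsWithin] with x hx hx0
  rw [slope_def_field, h0]
  exact div_nonpos_of_nonpos_of_nonneg (by linarith) (by simpa using le_of_lt hx0)

theorem digamma_re_le {s : ℂ} (hs : 0 < s.re) {M : ℝ}
    (hM : ∀ n : ℕ, ∑ k ∈ Finset.range n, 1 / (s.re + k) ^ 2 ≤ M) :
    (digamma s).re ≤ Real.log ‖s‖ + M := by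
  set A := Real.log ‖s‖ + M
  have hG0 : Complex.Gamma s ≠ 0 := Gamma_ne_zero_of_re_pos hs
  have hle : ∀ δ : ℝ, 0 < δ → δ ≤ 1 →
      ‖Complex.Gamma (s + δ)‖ ≤ ‖Complex.Gamma s‖ * Real.exp (δ * A) := by
    intro δ hδ hδ1
    refine le_of_tendsto_of_tendsto (GammaSeq_tendsto_Gamma (s + δ)).norm
      ((GammaSeq_tendsto_Gamma s).norm.mul_const _) ?_
    filter_upwards [eventually_gt_atTop 0] with n hn
    exact log_norm_Gamma_seq_bound hs hδ hδ1 hM hn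
  have hd : HasDerivAt (fun x : ℝ ↦ (Complex.Gamma (s + x) / Complex.Gamma s).re -
      Real.exp (x * A)) ((digamma s).re - A) 0 := by
    have hdG : HasDerivAt Complex.Gamma (deriv Complex.Gamma s) (s + (0 : ℝ)) := by
      simpa using (differentiableAt_Gamma s fun m h ↦ by
        have := congrArg Complex.re h
        simp at this
        linarith [Nat.cast_nonneg (α := ℝ) m]).hasDerivAt
    have h1 : HasDerivAt (fun y : ℝ ↦ s + (y : ℂ)) 1 0 := by
      simpa using (Complex.ofRealCLM.hasDerivAt (x := 0)).const_add s
    have h2 := reCLM.hasFDerivAt.comp_hasDerivAt (0 : ℝ)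
      ((hdG.comp (0 : ℝ) h1).div_const (Complex.Gamma s))
    have h3 : HasDerivAt (fun x : ℝ ↦ Real.exp (x * A)) A 0 := by
      simpa using ((hasDerivAt_id (0 : ℝ)).mul_const A).exp
    simpa [Function.comp_def, digamma_def, logDeriv_apply] using h2.fun_sub h3
  refine sub_nonpos.mp (hd.nonpos_of_nonpos_right (by simp [hG0]) ?_)
  filter_upwards [Ioc_mem_nhdsGT (zero_lt_one' ℝ)] with x hx
  refine sub_nonpos.mpr ((Complex.re_le_norm _).trans ?_)
  rw [norm_div, div_le_iff₀ (norm_pos_iff.mpr hG0), mul_comm]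
  exact hle x hx.1 hx.2

/-! ### The logarithmic derivative of `ζ` on the critical line -/

theorem Gammaℝ_conj (s : ℂ) :
    Gammaℝ (starRingEnd ℂ s) = starRingEnd ℂ (Gammaℝ s) := by
  have h : (starRingEnd ℂ) (-s / 2) = -(starRingEnd ℂ) s / 2 := by simp [map_ofNat]
  have h' : (starRingEnd ℂ) (s / 2) = (starRingEnd ℂ) s / 2 := by simp [map_ofNat]
  rw [Gammaℝ_def, Gammaℝ_def, map_mul, ← Complex.Gamma_conj, h', ← h,
    cpow_conj _ _ (by rw [Complex.arg_ofReal_of_nonneg Real.pi_nonneg]; exact Real.pi_ne_zero.symm),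
    Complex.conj_ofReal]

theorem completedRiemannZeta_conj {s : ℂ} (hs : 0 < s.re) :
    completedRiemannZeta (starRingEnd ℂ s) = starRingEnd ℂ (completedRiemannZeta s) := by
  have key : ∀ z : ℂ, 0 < z.re → completedRiemannZeta z = riemannZeta z * Gammaℝ z := by
    intro z hz
    rw [riemannZeta_def_of_ne_zero (by rintro rfl; simp at hz),
      div_mul_cancel₀ _ (Gammaℝ_ne_zero_of_re_pos hz)]
  rw [key s hs, key _ (by simpa using hs), riemannZeta_conj, Gammaℝ_conj, map_mul]

theorem logDeriv_completedRiemannZeta_re_eq_zero {s : ℂ} (hs : s.re = 1 / 2) :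
    (logDeriv completedRiemannZeta s).re = 0 := by
  have hconj : starRingEnd ℂ s = 1 - s := by
    apply Complex.ext <;> simp [hs]
    norm_num
  have hreal : starRingEnd ℂ (completedRiemannZeta s) = completedRiemannZeta s := by
    rw [← completedRiemannZeta_conj (by rw [hs]; norm_num), hconj, completedRiemannZeta_one_sub]
  have hrefl : deriv completedRiemannZeta (1 - s) = -deriv completedRiemannZeta s := by
    have h := deriv_comp_const_sub completedRiemannZeta 1 s
    simp only [completedRiemannZeta_one_sub] at h
    rw [h, neg_neg]
  have hev : (starRingEnd ℂ) ∘ completedRiemannZeta ∘ (starRingEnd ℂ) =ᶠ[𝓝 s]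
      completedRiemannZeta := by
    filter_upwards [(isOpen_lt continuous_const continuous_re).mem_nhds
      (show 0 < s.re by rw [hs]; norm_num)] with z hz
    simp [completedRiemannZeta_conj hz]
  have himag : starRingEnd ℂ (deriv completedRiemannZeta s) = -deriv completedRiemannZeta s := by
    have h := hev.deriv_eq
    rw [deriv_conj_conj, Function.comp_apply, Function.comp_apply, hconj, hrefl, map_neg] at h
    exact neg_eq_iff_eq_neg.mp h
  have h : starRingEnd ℂ (logDeriv completedRiemannZeta s) = -logDeriv completedRiemannZeta s := by
    rw [logDeriv_apply, map_div₀, himag, hreal, neg_div]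
  have := congrArg Complex.re h
  simp only [conj_re, neg_re] at this
  linarith

theorem logDeriv_Gammaℝ {s : ℂ} (hs : 0 < s.re) :
    logDeriv Gammaℝ s = -Real.log π / 2 + digamma (s / 2) / 2 := by
  have hs2 : 0 < (s / 2).re := by simpa using hs
  have hpi : (π : ℂ) ≠ 0 := by exact_mod_cast Real.pi_ne_zero
  have hG : DifferentiableAt ℂ Complex.Gamma (s / 2) := differentiableAt_Gamma _ fun m h ↦ by
    have := congrArg Complex.re h
    rw [neg_re, natCast_re] at this
    linarith [Nat.cast_nonneg (α := ℝ) m]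
  have h1 : HasDerivAt (fun z : ℂ ↦ (π : ℂ) ^ (-z / 2))
      ((π : ℂ) ^ (-s / 2) * Complex.log π * (-1 / 2)) s :=
    ((hasDerivAt_id s).neg.div_const 2).const_cpow (Or.inl hpi)
  have h2 : HasDerivAt (fun z : ℂ ↦ Complex.Gamma (z / 2))
      (deriv Complex.Gamma (s / 2) * (1 / 2)) s :=
    hG.hasDerivAt.comp s ((hasDerivAt_id s).div_const 2)
  have h3 : HasDerivAt Gammaℝ _ s := h1.mul h2
  have hp0 : (π : ℂ) ^ (-s / 2) ≠ 0 := by simp [hpi]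
  have hG0 : Complex.Gamma (s / 2) ≠ 0 := Gamma_ne_zero_of_re_pos hs2
  rw [logDeriv_apply, h3.deriv, Gammaℝ_def, digamma_def, logDeriv_apply,
    Complex.ofReal_log Real.pi_nonneg]
  field_simp

theorem logDeriv_riemannZeta_re {s : ℂ} (hs : s.re = 1 / 2) (h0 : riemannZeta s ≠ 0) :
    (logDeriv riemannZeta s).re = Real.log π / 2 - (digamma (s / 2)).re / 2 := by
  have hpos : 0 < s.re := by rw [hs]; norm_num
  have hs0 : s ≠ 0 := by rintro rfl; simp at hs
  have hs1 : s ≠ 1 := by rintro rfl; norm_num at hs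
  have hev : riemannZeta =ᶠ[𝓝 s] fun z ↦ completedRiemannZeta z / Gammaℝ z := by
    filter_upwards [isOpen_compl_singleton.mem_nhds hs0] with z hz
    exact riemannZeta_def_of_ne_zero hz
  have hG0 := Gammaℝ_ne_zero_of_re_pos hpos
  have hL0 : completedRiemannZeta s ≠ 0 := fun h ↦ h0 (by
    rw [riemannZeta_def_of_ne_zero hs0, h, zero_div])
  have hGd : DifferentiableAt ℂ Gammaℝ s := by
    have := (differentiable_Gammaℝ_inv s).inv (inv_ne_zero hG0)
    simpa [Pi.inv_def] using this
  rw [(logDeriv_congr_nhds hev).eq_of_nhds, logDeriv_div s hL0 hG0 (differentiableAt_completedZeta hs0 hs1) hGd,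
    Complex.sub_re, logDeriv_completedRiemannZeta_re_eq_zero hs, logDeriv_Gammaℝ hpos]
  simp only [Complex.add_re, Complex.neg_re, Complex.div_ofNat_re, Complex.ofReal_re, neg_div]
  ring

theorem exists_neg_logDeriv_riemannZeta_re_le :
    ∃ C : ℝ, 0 < C ∧ ∀ s : ℂ, s.re = 1 / 2 → 1 / 2 ≤ s.im → riemannZeta s ≠ 0 →
      -(logDeriv riemannZeta s).re ≤ Real.log s.im / 2 + C := by
  have hsum : Summable fun k : ℕ ↦ 1 / ((1 / 4 : ℝ) + k) ^ 2 := by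
    have h : Summable fun k : ℕ ↦ 16 * (1 / ((k + 1 : ℕ) : ℝ) ^ 2) :=
      ((summable_nat_add_iff 1).mpr (Real.summable_one_div_nat_pow.mpr one_lt_two)).mul_left 16
    refine h.of_nonneg_of_le (fun k ↦ by positivity) fun k ↦ ?_
    rw [mul_one_div, div_le_div_iff₀ (by positivity) (by positivity)]
    push_cast
    nlinarith [Nat.cast_nonneg (α := ℝ) k]
  set M := ∑' k : ℕ, 1 / ((1 / 4 : ℝ) + k) ^ 2
  have hM0 : 0 ≤ M := tsum_nonneg fun k ↦ by positivity
  refine ⟨M + 1, by linarith, fun s hs him h0 ↦ ?_⟩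
  have hre : (s / 2).re = 1 / 4 := by rw [Complex.div_ofNat_re, hs]; norm_num
  have hd := digamma_re_le (s := s / 2) (by rw [hre]; norm_num) (M := M) fun n ↦ by
    rw [hre]
    exact hsum.sum_le_tsum _ fun k _ ↦ by positivity
  have hnorm : ‖s / 2‖ ≤ s.im := by
    refine (Complex.norm_le_abs_re_add_abs_im _).trans ?_
    rw [hre, Complex.div_ofNat_im, abs_of_pos (by norm_num), abs_of_pos (by linarith)]
    linarith
  have hpos : 0 < ‖s / 2‖ := norm_pos_iff.mpr fun h ↦ by norm_num [h] at hre
  have hlog := Real.log_le_log hpos hnorm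
  have hpi : 0 ≤ Real.log π := Real.log_nonneg (by linarith [Real.pi_gt_three])
  rw [logDeriv_riemannZeta_re hs h0]
  linarith

/-! ### Local behaviour of the logarithmic derivative near the critical line -/

theorem analyticAt_riemannZeta {s : ℂ} (hs : s ≠ 1) : AnalyticAt ℂ riemannZeta s :=
  (differentiableOn_riemannZeta.analyticOnNhd isOpen_compl_singleton) s hs

theorem differentiableAt_logDeriv_riemannZeta {s : ℂ} (hs : s ≠ 1) (h0 : riemannZeta s ≠ 0) :
    DifferentiableAt ℂ (logDeriv riemannZeta) s :=
  (analyticAt_riemannZeta hs).deriv.differentiableAt.div (differentiableAt_riemannZeta hs) h0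

theorem exists_logDeriv_riemannZeta_eq {s : ℂ} (hs : s ≠ 1) :
    ∃ (m : ℕ) (f : ℂ → ℂ), ContinuousAt f s ∧
      ∀ᶠ z in 𝓝[≠] s, riemannZeta z ≠ 0 ∧ logDeriv riemannZeta z = m / (z - s) + f z := by
  have han : AnalyticOnNhd ℂ riemannZeta {1}ᶜ := fun z hz ↦ analyticAt_riemannZeta hz
  have hne : ¬∀ᶠ z in 𝓝 s, riemannZeta z = 0 := fun h ↦ by
    have hconn : IsPreconnected ({1}ᶜ : Set ℂ) :=
      (isConnected_compl_singleton_of_one_lt_rank (by simp) 1).isPreconnected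
    have h2 := han.eqOn_zero_of_preconnected_of_eventuallyEq_zero hconn hs h
      (show (2 : ℂ) ∈ ({1}ᶜ : Set ℂ) by simp)
    exact riemannZeta_ne_zero_of_one_lt_re (s := 2) (by simp) h2
  obtain ⟨m, g, hg, hg0, hev⟩ := (han s hs).exists_eventuallyEq_pow_smul_nonzero_iff.mpr hne
  refine ⟨m, logDeriv g, hg.deriv.continuousAt.div hg.continuousAt hg0, ?_⟩
  filter_upwards [hev.eventually_nhds.filter_mono nhdsWithin_le_nhds,
    (hg.continuousAt.eventually_ne hg0).filter_mono nhdsWithin_le_nhds,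
    hg.eventually_analyticAt.filter_mono nhdsWithin_le_nhds, self_mem_nhdsWithin]
    with z hz hgz hgd hzs
  have hzs' : z - s ≠ 0 := sub_ne_zero.mpr hzs
  have hpow : (z - s) ^ m ≠ 0 := pow_ne_zero _ hzs'
  refine ⟨by simpa [hz.self_of_nhds, hgz] using fun h ↦ absurd h hzs', ?_⟩
  have hz' : riemannZeta =ᶠ[𝓝 z] fun w ↦ (w - s) ^ m * g w := hz
  rw [(logDeriv_congr_nhds hz').eq_of_nhds,
    logDeriv_mul z hpow hgz (by fun_prop) hgd.differentiableAt,
    logDeriv_fun_pow (f := fun w ↦ w - s) (by fun_prop), logDeriv_apply]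
  simp [div_eq_mul_inv]

theorem eventually_neg_le_logDeriv_riemannZeta_re {s : ℂ} (hs : s.re = 1 / 2)
    (him : 1 / 2 < s.im) {C K : ℝ}
    (hC : ∀ z : ℂ, z.re = 1 / 2 → 1 / 2 ≤ z.im → riemannZeta z ≠ 0 →
      -(logDeriv riemannZeta z).re ≤ Real.log z.im / 2 + C)
    (hK : Real.log s.im / 2 + C < K) :
    ∀ᶠ z in 𝓝 s, 1 / 2 < z.re → -K ≤ (logDeriv riemannZeta z).re := by
  obtain ⟨m, f, hf, hev⟩ := exists_logDeriv_riemannZeta_eq (s := s)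
    (by rintro rfl; norm_num at hs)
  have hpath : Tendsto (fun y : ℝ ↦ s + y * I) (𝓝[≠] 0) (𝓝[≠] s) := by
    refine tendsto_nhdsWithin_iff.mpr ⟨?_, ?_⟩
    · have : Continuous fun y : ℝ ↦ s + y * I := by fun_prop
      simpa using (this.tendsto 0).mono_left nhdsWithin_le_nhds
    · filter_upwards [self_mem_nhdsWithin] with y hy
      simpa using hy
  have hfs : -(f s).re ≤ Real.log s.im / 2 + C := by
    have h1 : Tendsto (fun y : ℝ ↦ -(f (s + y * I)).re) (𝓝[≠] 0) (𝓝 (-(f s).re)) :=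
      ((Complex.continuous_re.tendsto _).comp
        (hf.tendsto.comp (hpath.mono_right nhdsWithin_le_nhds))).neg
    have h2 : Tendsto (fun y : ℝ ↦ Real.log (s.im + y) / 2 + C) (𝓝[≠] 0)
        (𝓝 (Real.log s.im / 2 + C)) := by
      have : ContinuousAt (fun y : ℝ ↦ Real.log (s.im + y) / 2 + C) 0 :=
        (((continuousAt_const.add continuousAt_id).log (by simp; linarith)).div_const 2).add
          continuousAt_const
      simpa using this.tendsto.mono_left nhdsWithin_le_nhds
    refine le_of_tendsto_of_tendsto h1 h2 ?_
    have hge : ∀ᶠ y : ℝ in 𝓝[≠] 0, 1 / 2 - s.im ≤ y :=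
      (eventually_ge_nhds (by linarith)).filter_mono nhdsWithin_le_nhds
    filter_upwards [hpath.eventually hev, hge] with y hy hy2
    have h3 := hC (s + y * I) (by simpa using hs) (by simp; linarith) hy.1
    have h4 : ((m : ℂ) / (s + y * I - s)).re = 0 := by
      rw [add_sub_cancel_left, Complex.div_re]
      simp
    rw [hy.2, Complex.add_re, h4] at h3
    simpa using h3
  have hcont : ∀ᶠ z in 𝓝 s, -K < (f z).re :=
    ((Complex.continuous_re.continuousAt.comp hf).eventually_const_lt
      (show -K < (f s).re by linarith))
  filter_upwards [hcont, eventually_nhdsWithin_iff.mp hev] with z hz hz2 hre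
  have hzs : z ≠ s := by rintro rfl; linarith
  rw [(hz2 hzs).2, Complex.add_re]
  have : 0 ≤ ((m : ℂ) / (z - s)).re := by
    rw [Complex.div_re]
    simp only [natCast_re, natCast_im, sub_re, zero_mul, zero_div, add_zero]
    exact div_nonneg (mul_nonneg m.cast_nonneg (by linarith)) (normSq_nonneg _)
  linarith

theorem eventually_forall_neg_le_logDeriv_riemannZeta_re {a b C K : ℝ} (ha : 1 / 2 < a)
    (hC : ∀ z : ℂ, z.re = 1 / 2 → 1 / 2 ≤ z.im → riemannZeta z ≠ 0 →
      -(logDeriv riemannZeta z).re ≤ Real.log z.im / 2 + C)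
    (hK : Real.log b / 2 + C < K) :
    ∀ᶠ x : ℝ in 𝓝 (1 / 2), ∀ v ∈ Set.Icc a b, 1 / 2 < x →
      -K ≤ (logDeriv riemannZeta ((x : ℂ) + (v : ℂ) * I)).re := by
  refine isCompact_Icc.eventually_forall_of_forall_eventually fun v hv ↦ ?_
  have hlog : Real.log v ≤ Real.log b := Real.log_le_log (by linarith [hv.1]) hv.2
  have h := eventually_neg_le_logDeriv_riemannZeta_re (s := ((1 / 2 : ℝ) : ℂ) + (v : ℂ) * I)
    (by simp) (by simpa using ha.trans_le hv.1) hC (K := K) (by simpa using by linarith)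
  have hcont : Continuous fun p : ℝ × ℝ ↦ (p.1 : ℂ) + (p.2 : ℂ) * I := by fun_prop
  filter_upwards [(hcont.tendsto (1 / 2, v)).eventually h] with p hp hlt
  exact hp (by simpa using hlt)

theorem ae_riemannZeta_ne_zero {a b : ℝ} (ha : 0 < a) :
    ∀ᵐ v : ℝ ∂volume.restrict (Set.Icc a b), riemannZeta (((1 / 2 : ℝ) : ℂ) + (v : ℂ) * I) ≠ 0 := by
  refine ae_restrict_le_codiscreteWithin measurableSet_Icc ?_
  rw [mem_codiscreteWithin]
  intro v hv
  rw [disjoint_principal_right]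
  obtain ⟨_, _, _, hev⟩ := exists_logDeriv_riemannZeta_eq
    (s := ((1 / 2 : ℝ) : ℂ) + (v : ℂ) * I) (fun h ↦ by
      have := congrArg Complex.im h
      simp at this
      linarith [hv.1])
  have hpath : Tendsto (fun y : ℝ ↦ ((1 / 2 : ℝ) : ℂ) + (y : ℂ) * I) (𝓝[≠] v)
      (𝓝[≠] (((1 / 2 : ℝ) : ℂ) + (v : ℂ) * I)) := by
    refine tendsto_nhdsWithin_iff.mpr ⟨?_, ?_⟩
    · have : Continuous fun y : ℝ ↦ ((1 / 2 : ℝ) : ℂ) + (y : ℂ) * I := by fun_prop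
      exact (this.tendsto v).mono_left nhdsWithin_le_nhds
    · filter_upwards [self_mem_nhdsWithin] with y hy
      simpa using hy
  filter_upwards [hpath.eventually hev] with y hy
  exact fun h ↦ h.2 hy.1

/-! ### The logarithmic derivative to the right of the critical line -/

theorem RiemannHypothesis.riemannZeta_ne_zero (hRH : RiemannHypothesis) {s : ℂ}
    (hs : 1 / 2 < s.re) (h1 : s ≠ 1) : riemannZeta s ≠ 0 := fun h0 ↦ by
  refine hs.ne' (hRH s h0 ?_ h1)
  rintro ⟨n, rfl⟩
  have h : ((-2 : ℂ) * (n + 1)).re = -2 * (n + 1) := by simp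
  rw [h] at hs
  linarith [Nat.cast_nonneg (α := ℝ) n]

open ArithmeticFunction in
theorem exists_norm_logDeriv_riemannZeta_le :
    ∃ B : ℝ, 0 ≤ B ∧ ∀ s : ℂ, 2 ≤ s.re →
      ‖logDeriv riemannZeta s‖ ≤ B * Real.exp (-Real.log 2 * s.re) := by
  set c : ℕ → ℂ := fun n ↦ (vonMangoldt n : ℂ)
  have hsum : Summable fun n ↦ ‖LSeries.term c 2 n‖ :=
    (LSeriesSummable_vonMangoldt (s := 2) (by simp)).norm
  refine ⟨(∑' n, ‖LSeries.term c 2 n‖) * Real.exp (Real.log 2 * 2),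
    mul_nonneg (tsum_nonneg fun _ ↦ norm_nonneg _) (Real.exp_nonneg _), fun s hs ↦ ?_⟩
  have hterm : ∀ n, ‖LSeries.term c s n‖ ≤
      ‖LSeries.term c 2 n‖ * Real.exp (Real.log 2 * (2 - s.re)) := by
    intro n
    rw [LSeries.norm_term_eq, LSeries.norm_term_eq]
    rcases Nat.lt_or_ge n 2 with hn | hn
    · interval_cases n <;> simp [c]
    · have hn0 : (0 : ℝ) < n := by positivity
      have hn2 : (2 : ℝ) ≤ n := by exact_mod_cast hn
      rw [if_neg (by lia), if_neg (by lia), div_mul_eq_mul_div, div_eq_mul_inv, div_eq_mul_inv,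
        mul_assoc]
      refine mul_le_mul_of_nonneg_left ?_ (norm_nonneg _)
      rw [← Real.rpow_neg hn0.le, ← Real.rpow_neg hn0.le, Real.rpow_def_of_pos hn0,
        Real.rpow_def_of_pos hn0, ← Real.exp_add]
      have hlog : Real.log 2 ≤ Real.log n := Real.log_le_log two_pos hn2
      refine Real.exp_le_exp.mpr ?_
      simp only [Complex.re_ofNat]
      nlinarith
  have hsum' := hsum.mul_right (Real.exp (Real.log 2 * (2 - s.re)))
  have hL : ‖logDeriv riemannZeta s‖ = ‖LSeries c s‖ := by
    rw [LSeries_vonMangoldt_eq_deriv_riemannZeta_div (by linarith), neg_div, norm_neg,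
      logDeriv_apply]
  rw [hL, mul_assoc, ← Real.exp_add]
  refine (norm_tsum_le_tsum_norm (hsum'.of_nonneg_of_le (fun _ ↦ norm_nonneg _) hterm)).trans ?_
  refine ((hsum'.of_nonneg_of_le (fun _ ↦ norm_nonneg _) hterm).tsum_le_tsum hterm hsum').trans ?_
  rw [tsum_mul_right]
  refine le_of_eq ?_
  ring_nf

theorem ofReal_add_mul_I_ne_one {x v : ℝ} (hv : v ≠ 0) : (x : ℂ) + (v : ℂ) * I ≠ 1 := fun h ↦
  hv (by simpa using congrArg Complex.im h)

theorem integrableOn_logDeriv_riemannZeta_im (hRH : RiemannHypothesis) {t : ℝ} (ht : t ≠ 0)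
    (h0 : riemannZeta (((1 / 2 : ℝ) : ℂ) + (t : ℂ) * I) ≠ 0) :
    IntegrableOn (fun σ : ℝ ↦ (logDeriv riemannZeta ((σ : ℂ) + (t : ℂ) * I)).im)
      (Set.Ioi (1 / 2)) := by
  obtain ⟨B, -, hB⟩ := exists_norm_logDeriv_riemannZeta_le
  refine integrable_of_isBigO_exp_neg (b := Real.log 2) (Real.log_pos one_lt_two) ?_ ?_
  · intro σ hσ
    have hne : riemannZeta ((σ : ℂ) + (t : ℂ) * I) ≠ 0 := by
      rcases (Set.mem_Ici.mp hσ).eq_or_lt with rfl | h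
      · exact h0
      · exact hRH.riemannZeta_ne_zero (by simpa using h) (ofReal_add_mul_I_ne_one ht)
    have hline : ContinuousAt (fun σ : ℝ ↦ (σ : ℂ) + (t : ℂ) * I) σ := by fun_prop
    exact (Complex.continuous_im.continuousAt.comp
      ((differentiableAt_logDeriv_riemannZeta (ofReal_add_mul_I_ne_one ht) hne).continuousAt.comp
        (f := fun σ : ℝ ↦ (σ : ℂ) + (t : ℂ) * I) hline)).continuousWithinAt
  · refine Asymptotics.IsBigO.of_bound B ?_
    filter_upwards [eventually_ge_atTop 2] with σ hσ
    have h := hB ((σ : ℂ) + (t : ℂ) * I) (by simpa using hσ)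
    rw [Real.norm_eq_abs, Real.norm_eq_abs, abs_of_pos (Real.exp_pos _)]
    exact (Complex.abs_im_le_norm _).trans (by simpa using h)

/-- Cauchy's theorem for `ζ'/ζ` on a rectangle to the right of the critical line. -/
theorem integral_logDeriv_riemannZeta_rect (hRH : RiemannHypothesis) {x R t u : ℝ}
    (hx : 1 / 2 < x) (hxR : x ≤ R) (ht : 0 < t) (htu : t ≤ u) :
    (∫ σ in x..R, (logDeriv riemannZeta ((σ : ℂ) + (t : ℂ) * I)).im) -
        (∫ σ in x..R, (logDeriv riemannZeta ((σ : ℂ) + (u : ℂ) * I)).im) =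
      (∫ v in t..u, (logDeriv riemannZeta ((x : ℂ) + (v : ℂ) * I)).re) -
        ∫ v in t..u, (logDeriv riemannZeta ((R : ℂ) + (v : ℂ) * I)).re := by
  have hd : ∀ σ v : ℝ, x ≤ σ → t ≤ v →
      DifferentiableAt ℂ (logDeriv riemannZeta) ((σ : ℂ) + (v : ℂ) * I) := fun σ v hσ hv ↦
    have h1 := ofReal_add_mul_I_ne_one (x := σ) (ht.trans_le hv).ne'
    differentiableAt_logDeriv_riemannZeta h1
      (hRH.riemannZeta_ne_zero (by simpa using hx.trans_le hσ) h1)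
  have hhor : ∀ v : ℝ, t ≤ v → IntervalIntegrable
      (fun σ : ℝ ↦ logDeriv riemannZeta ((σ : ℂ) + (v : ℂ) * I)) volume x R := by
    intro v hv
    refine ContinuousOn.intervalIntegrable fun σ hσ ↦ ?_
    rw [Set.uIcc_of_le hxR] at hσ
    exact ((hd σ v hσ.1 hv).continuousAt.comp
      (f := fun σ : ℝ ↦ (σ : ℂ) + (v : ℂ) * I) (by fun_prop)).continuousWithinAt
  have hver : ∀ σ : ℝ, x ≤ σ → IntervalIntegrable
      (fun v : ℝ ↦ logDeriv riemannZeta ((σ : ℂ) + (v : ℂ) * I)) volume t u := by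
    intro σ hσ
    refine ContinuousOn.intervalIntegrable fun v hv ↦ ?_
    rw [Set.uIcc_of_le htu] at hv
    exact ((hd σ v hσ hv.1).continuousAt.comp
      (f := fun v : ℝ ↦ (σ : ℂ) + (v : ℂ) * I) (by fun_prop)).continuousWithinAt
  have h := integral_boundary_rect_eq_zero_of_differentiableOn (logDeriv riemannZeta)
    ((x : ℂ) + (t : ℂ) * I) ((R : ℂ) + (u : ℂ) * I) (fun z hz ↦ by
      rw [mem_reProdIm] at hz
      simp only [add_re, ofReal_re, mul_re, I_re, mul_zero, ofReal_im, I_im, mul_one, sub_self,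
        add_zero, add_im, mul_im, zero_add, Set.uIcc_of_le hxR, Set.uIcc_of_le htu] at hz
      have := hd z.re z.im hz.1.1 hz.2.1
      rw [re_add_im] at this
      exact this.differentiableWithinAt)
  have him := congrArg Complex.im h
  simp only [add_re, ofReal_re, mul_re, I_re, mul_zero, ofReal_im, I_im, mul_one, sub_self,
    add_zero, add_im, mul_im, zero_add, sub_im, smul_eq_mul, zero_mul, one_mul, zero_im] at him
  have im_eq : ∀ v : ℝ, t ≤ v → (∫ σ in x..R, logDeriv riemannZeta ((σ : ℂ) + (v : ℂ) * I)).im =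
      ∫ σ in x..R, (logDeriv riemannZeta ((σ : ℂ) + (v : ℂ) * I)).im := fun v hv ↦
    (imCLM.intervalIntegral_comp_comm (hhor v hv)).symm
  have re_eq : ∀ σ : ℝ, x ≤ σ → (∫ v in t..u, logDeriv riemannZeta ((σ : ℂ) + (v : ℂ) * I)).re =
      ∫ v in t..u, (logDeriv riemannZeta ((σ : ℂ) + (v : ℂ) * I)).re := fun σ hσ ↦
    (reCLM.intervalIntegral_comp_comm (hver σ hσ)).symm
  rw [im_eq t le_rfl, im_eq u htu, re_eq x le_rfl, re_eq R hxR] at him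
  linarith

/-! ### Quasi-monotonicity of `S` -/

theorem S_sub_le (hRH : RiemannHypothesis) {t u K : ℝ} (ht : 0 < t) (htu : t ≤ u)
    (ht0 : riemannZeta (((1 / 2 : ℝ) : ℂ) + (t : ℂ) * I) ≠ 0)
    (hu0 : riemannZeta (((1 / 2 : ℝ) : ℂ) + (u : ℂ) * I) ≠ 0)
    (hK : ∀ᶠ x : ℝ in 𝓝 (1 / 2), ∀ v ∈ Set.Icc t u, 1 / 2 < x →
      -K ≤ (logDeriv riemannZeta ((x : ℂ) + (v : ℂ) * I)).re) :
    S t - S u ≤ K / π * (u - t) := by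
  obtain ⟨B, hB0, hB⟩ := exists_norm_logDeriv_riemannZeta_le
  set F : ℝ → ℝ → ℝ := fun v σ ↦ (logDeriv riemannZeta ((σ : ℂ) + (v : ℂ) * I)).im
  have hint_t : IntegrableOn (F t) (Set.Ioi (1 / 2)) :=
    integrableOn_logDeriv_riemannZeta_im hRH ht.ne' ht0
  have hint_u : IntegrableOn (F u) (Set.Ioi (1 / 2)) :=
    integrableOn_logDeriv_riemannZeta_im hRH (ht.trans_le htu).ne' hu0
  have hR : ∀ R : ℝ, 2 ≤ R → -K * (u - t) - B * Real.exp (-Real.log 2 * R) * (u - t) ≤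
      (∫ σ in (1 / 2 : ℝ)..R, F t σ) - ∫ σ in (1 / 2 : ℝ)..R, F u σ := by
    intro R hR
    have hcont : ∀ f : ℝ → ℝ, IntegrableOn f (Set.Ioi (1 / 2)) →
        Tendsto (fun x ↦ ∫ σ in x..R, f σ) (𝓝[>] (1 / 2)) (𝓝 (∫ σ in (1 / 2 : ℝ)..R, f σ)) := by
      intro f hf
      have h12 : (1 / 2 : ℝ) ≤ R := by linarith
      have hf' : IntegrableOn f (Set.uIcc (1 / 2) R) := by
        rw [Set.uIcc_of_le h12]
        exact ((integrableOn_Ici_iff_integrableOn_Ioi (by finiteness)).mpr hf).mono_set Set.Icc_subset_Ici_self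
      have h := intervalIntegral.continuousOn_primitive_interval_left hf' (1 / 2)
        Set.left_mem_uIcc
      refine h.tendsto.mono_left (nhdsWithin_le_of_mem ?_)
      rw [Set.uIcc_of_le h12]
      exact Icc_mem_nhdsGT (by linarith)
    refine ge_of_tendsto ((hcont _ hint_t).sub (hcont _ hint_u)) ?_
    filter_upwards [hK.filter_mono nhdsWithin_le_nhds, Ioc_mem_nhdsGT (show (1 / 2 : ℝ) < R by
      linarith)] with x hx hxR
    have hd : ∀ σ v : ℝ, 1 / 2 < σ → t ≤ v → ContinuousAt
        (fun v : ℝ ↦ (logDeriv riemannZeta ((σ : ℂ) + (v : ℂ) * I)).re) v := fun σ v hσ hv ↦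
      have h1 := ofReal_add_mul_I_ne_one (x := σ) (ht.trans_le hv).ne'
      Complex.continuous_re.continuousAt.comp ((differentiableAt_logDeriv_riemannZeta h1
        (hRH.riemannZeta_ne_zero (by simpa using hσ) h1)).continuousAt.comp
          (f := fun v : ℝ ↦ (σ : ℂ) + (v : ℂ) * I) (by fun_prop))
    have hi : ∀ σ : ℝ, 1 / 2 < σ → IntervalIntegrable
        (fun v : ℝ ↦ (logDeriv riemannZeta ((σ : ℂ) + (v : ℂ) * I)).re) volume t u :=
      fun σ hσ ↦ ContinuousOn.intervalIntegrable fun v hv ↦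
        (hd σ v hσ (by rw [Set.uIcc_of_le htu] at hv; exact hv.1)).continuousWithinAt
    have h1 := integral_logDeriv_riemannZeta_rect hRH hxR.1 hxR.2 ht htu
    have h2 : ∫ _ in t..u, -K ≤ ∫ v in t..u, (logDeriv riemannZeta ((x : ℂ) + (v : ℂ) * I)).re :=
      intervalIntegral.integral_mono_on htu (by simp) (hi x hxR.1) fun v hv ↦ hx v hv hxR.1
    have h3 : ∫ v in t..u, (logDeriv riemannZeta ((R : ℂ) + (v : ℂ) * I)).re ≤
        ∫ _ in t..u, B * Real.exp (-Real.log 2 * R) :=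
      intervalIntegral.integral_mono_on htu (hi R (by linarith)) (by simp) fun v _ ↦
        (Complex.re_le_norm _).trans
          (by simpa using hB ((R : ℂ) + (v : ℂ) * I) (by simpa using hR))
    rw [intervalIntegral.integral_const, smul_eq_mul] at h2 h3
    simp only [F]
    linarith
  have hlim := (intervalIntegral_tendsto_integral_Ioi _ hint_t tendsto_id).sub
    (intervalIntegral_tendsto_integral_Ioi _ hint_u tendsto_id)
  have hexp : Tendsto (fun R ↦ -K * (u - t) - B * Real.exp (-Real.log 2 * R) * (u - t)) atTop
      (𝓝 (-K * (u - t) - B * 0 * (u - t))) := by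
    refine tendsto_const_nhds.sub ((Tendsto.const_mul B ?_).mul_const _)
    exact Real.tendsto_exp_atBot.comp
      (tendsto_id.const_mul_atTop_of_neg (neg_lt_zero.mpr (Real.log_pos one_lt_two)))
  have h := le_of_tendsto_of_tendsto hexp hlim (by
    filter_upwards [eventually_ge_atTop 2] with R hR2 using hR R hR2)
  have hS : ∀ v, S v = -(1 / π) * ∫ σ in Set.Ioi (1 / 2 : ℝ), F v σ := fun v ↦ rfl
  have hpi := Real.pi_pos
  rw [hS, hS, div_mul_eq_mul_div, le_div_iff₀ hpi]
  field_simp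
  linarith

/-- A function that loses at most `L * (y - x)` between points `x ≤ y` of a set of full measure is
integrable, and its mean is controlled by its values at the endpoints. -/
theorem intervalIntegrable_and_bounds_of_sub_le {f : ℝ → ℝ} {a b L : ℝ} {N : Set ℝ}
    (hab : a ≤ b) (hN : MeasurableSet N) (hae : ∀ᵐ x ∂volume.restrict (Set.Icc a b), x ∈ N)
    (haN : a ∈ N) (hbN : b ∈ N)
    (hL : ∀ x ∈ N ∩ Set.Icc a b, ∀ y ∈ N ∩ Set.Icc a b, x ≤ y → f x - f y ≤ L * (y - x)) :
    f a * (b - a) - L * (b - a) ^ 2 / 2 ≤ ∫ x in a..b, f x ∧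
      ∫ x in a..b, f x ≤ f b * (b - a) + L * (b - a) ^ 2 / 2 := by
  set s := N ∩ Set.Icc a b
  have has : a ∈ s := ⟨haN, Set.left_mem_Icc.mpr hab⟩
  have hbs : b ∈ s := ⟨hbN, Set.right_mem_Icc.mpr hab⟩
  have hmono : MonotoneOn (fun x ↦ f x + L * x) s := fun x hx y hy hxy ↦ by
    have := hL x hx y hy hxy
    dsimp only
    linarith
  have hs_ae : s =ᵐ[volume] Set.Icc a b := by
    filter_upwards [(ae_restrict_iff' measurableSet_Icc).mp hae] with x hx
    exact propext ⟨fun h ↦ h.2, fun h ↦ ⟨hx h, h⟩⟩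
  have hs_meas : MeasurableSet s := hN.inter measurableSet_Icc
  have hint_s : IntegrableOn (fun x ↦ f x + L * x) s := by
    refine IntegrableOn.of_bound ?_ (aemeasurable_restrict_of_monotoneOn hs_meas
      hmono).aestronglyMeasurable (max |f a + L * a| |f b + L * b|) ?_
    · rw [measure_congr hs_ae]
      simp
    · refine (ae_restrict_iff' hs_meas).mpr (ae_of_all _ fun x hx ↦ ?_)
      exact abs_le_max_abs_abs (hmono has hx hx.2.1) (hmono hx hbs hx.2.2)
  have hint : IntervalIntegrable f volume a b := by
    rw [intervalIntegrable_iff_integrableOn_Icc_of_le hab]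
    have h := ((integrableOn_congr_set_ae hs_ae).mp hint_s).sub
      ((continuous_const.mul continuous_id : Continuous fun x : ℝ ↦ L * x).integrableOn_Icc)
    simpa [Pi.sub_def] using h
  have hlin : ∀ c d : ℝ, ∫ x in a..b, (c + L * (x - d)) =
      c * (b - a) + L * ((b - d) ^ 2 - (a - d) ^ 2) / 2 := by
    intro c d
    rw [intervalIntegral.integral_add (by simp) (Continuous.intervalIntegrable (by fun_prop) _ _),
      intervalIntegral.integral_const_mul,
      intervalIntegral.integral_comp_sub_right (fun x ↦ x) d, integral_id]
    simp
    ring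
  have hlin' : ∀ c d : ℝ, ∫ x in a..b, (c - L * (x - d)) =
      c * (b - a) - L * ((b - d) ^ 2 - (a - d) ^ 2) / 2 := by
    intro c d
    rw [intervalIntegral.integral_sub (by simp) (Continuous.intervalIntegrable (by fun_prop) _ _),
      intervalIntegral.integral_const_mul,
      intervalIntegral.integral_comp_sub_right (fun x ↦ x) d, integral_id]
    simp
    ring
  constructor
  · have h := intervalIntegral.integral_mono_ae_restrict hab
      (Continuous.intervalIntegrable (by fun_prop) _ _ : IntervalIntegrable
        (fun x ↦ f a - L * (x - a)) volume a b) hint (by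
      filter_upwards [hae, ae_restrict_mem measurableSet_Icc] with x hx hxI
      have := hL a has x ⟨hx, hxI⟩ hxI.1
      linarith)
    rw [hlin'] at h
    linarith
  · have h := intervalIntegral.integral_mono_ae_restrict hab hint
      (Continuous.intervalIntegrable (by fun_prop) _ _ : IntervalIntegrable
        (fun x ↦ f b - L * (x - b)) volume a b) (by
      filter_upwards [hae, ae_restrict_mem measurableSet_Icc] with x hx hxI
      have := hL x ⟨hx, hxI⟩ b hbs hxI.2
      linarith)
    rw [hlin'] at h
    linarith

theorem integral_S_bounds (hRH : RiemannHypothesis) {a b C K : ℝ} (ha : 1 / 2 < a) (hab : a ≤ b)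
    (hC : ∀ z : ℂ, z.re = 1 / 2 → 1 / 2 ≤ z.im → riemannZeta z ≠ 0 →
      -(logDeriv riemannZeta z).re ≤ Real.log z.im / 2 + C)
    (hK : Real.log b / 2 + C < K)
    (ha0 : ¬ IsZetaZeroOrdinate a) (hb0 : ¬ IsZetaZeroOrdinate b) :
    S a * (b - a) - K / π * (b - a) ^ 2 / 2 ≤ ∫ u in a..b, S u ∧
      ∫ u in a..b, S u ≤ S b * (b - a) + K / π * (b - a) ^ 2 / 2 := by
  have hmem : ∀ v : ℝ, ¬ IsZetaZeroOrdinate v →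
      riemannZeta (((1 / 2 : ℝ) : ℂ) + (v : ℂ) * I) ≠ 0 := fun v hv h ↦
    hv ⟨_, h, by simp, by norm_num, by simp⟩
  have hbig : MeasurableSet
      {v : ℝ | v ≠ 0 ∧ riemannZeta (((1 / 2 : ℝ) : ℂ) + (v : ℂ) * I) ≠ 0} := by
    refine IsOpen.measurableSet (isOpen_iff_mem_nhds.mpr fun v hv ↦ ?_)
    have hline : ContinuousAt (fun v : ℝ ↦ ((1 / 2 : ℝ) : ℂ) + (v : ℂ) * I) v := by fun_prop
    have hcont : ContinuousAt (fun v : ℝ ↦ riemannZeta (((1 / 2 : ℝ) : ℂ) + (v : ℂ) * I)) v :=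
      (differentiableAt_riemannZeta (ofReal_add_mul_I_ne_one hv.1)).continuousAt.comp
        (f := fun v : ℝ ↦ ((1 / 2 : ℝ) : ℂ) + (v : ℂ) * I) hline
    filter_upwards [hcont.eventually_ne hv.2, isOpen_ne.mem_nhds hv.1] with y hy hy0
    exact ⟨hy0, hy⟩
  have hlower := eventually_forall_neg_le_logDeriv_riemannZeta_re ha hC hK
  refine intervalIntegrable_and_bounds_of_sub_le hab hbig ?_ ⟨by linarith, hmem a ha0⟩
    ⟨by linarith, hmem b hb0⟩ fun x hx y hy hxy ↦ ?_
  · filter_upwards [ae_riemannZeta_ne_zero (b := b) (show 0 < a by linarith),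
      ae_restrict_mem measurableSet_Icc] with v hv hvI
    exact ⟨by linarith [hvI.1], hv⟩
  · refine S_sub_le hRH (by linarith [hx.2.1]) hxy hx.1.2 hy.1.2 ?_
    filter_upwards [hlower] with w hw v hv
    exact hw v ⟨hx.2.1.trans hv.1, hv.2.trans hy.2.2⟩

theorem S_between_averages (hRH : RiemannHypothesis) :
    ∃ C > 0, ∀ t h : ℝ, 2 ≤ t → 0 < h → h ≤ Real.sqrt t →
      ¬ IsZetaZeroOrdinate t → ¬ IsZetaZeroOrdinate (t - h) → ¬ IsZetaZeroOrdinate (t + h) →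
      (-(h * Real.log t) / (4 * π) + (1 / h) * (∫ u in (t - h)..t, S u) - C * (h + 1 / t) ≤ S t ∧
        S t ≤ h * Real.log t / (4 * π) + (1 / h) * (∫ u in t..(t + h), S u) + C * (h + 1 / t)) := by
  obtain ⟨C, hC0, hC⟩ := exists_neg_logDeriv_riemannZeta_re_le
  have hlog2 : 0 < Real.log 2 := Real.log_pos one_lt_two
  refine ⟨Real.log 2 / 2 + C + 1, by linarith, fun t h ht hh hht h0 hm hp ↦ ?_⟩
  have hsq : Real.sqrt t ^ 2 = t := Real.sq_sqrt (by linarith)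
  have hs0 := Real.sqrt_nonneg t
  have hs1 : 1.4 ≤ Real.sqrt t := Real.le_sqrt_of_sq_le (by norm_num; linarith)
  have hta : 1 / 2 < t - h := by nlinarith
  have hpi := Real.pi_pos
  have hpi1 : 1 ≤ π := by linarith [Real.pi_gt_three]
  set D := Real.log 2 / 2 + C + 1
  set K := Real.log t / 2 + D
  have hD : 0 < D := by positivity
  have hK : ∀ b : ℝ, 0 < b → b ≤ 2 * t → Real.log b / 2 + C < K := by
    intro b hb hbt
    have := Real.log_le_log hb hbt
    rw [Real.log_mul two_ne_zero (by linarith)] at this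
    simp only [K, D]
    linarith
  have hKh : K / π * h ^ 2 / 2 = h * (h * Real.log t / (4 * π)) + D * h ^ 2 / (2 * π) := by
    simp only [K]
    field_simp
    ring
  have hDh : D * h ^ 2 / (2 * π) ≤ h * (D * (h + 1 / t)) := by
    have h1 : D * h ^ 2 / (2 * π) ≤ D * h ^ 2 := div_le_self (by positivity) (by linarith)
    have h2 : 0 ≤ h * (D * (1 / t)) := by positivity
    nlinarith
  have hl := (integral_S_bounds hRH hta (by linarith) hC (hK t (by linarith) (by linarith))
    hm h0).2
  have hr := (integral_S_bounds hRH (by linarith) (by linarith) hC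
    (hK (t + h) (by linarith) (by nlinarith)) h0 hp).1
  rw [sub_sub_cancel, hKh] at hl
  rw [add_sub_cancel_left, hKh] at hr
  constructor
  · refine le_of_mul_le_mul_left ?_ hh
    rw [mul_sub, mul_add, ← mul_assoc h (1 / h), mul_one_div_cancel hh.ne', one_mul, neg_div]
    linarith
  · refine le_of_mul_le_mul_left ?_ hh
    rw [mul_add, mul_add, ← mul_assoc h (1 / h), mul_one_div_cancel hh.ne', one_mul]
    linarith
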